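/- Let m ≥ 2, let Ω ⊂ ℝ^m be a bounded open set, θ ∈ (0, 1/4), φ : ℝ^m → ℝ a C^∞ function with |Dφ| ≤ 1 − 4θ on the closure of Ω, Λ ≥ 0 and I₁ ≥ 0. There exists a constant C, depending only on m, Ω, φ, θ, Λ and I₁, such that for every admissible solution u with source ρ satisfying ∫_Ω |ρ| dx ≤ I₁, and for every x ∈ Ω, writing r_x := dist(x, ∂Ω)/2, one has ∫_{B_r(x)} w_u dx ≤ (C / r_x) · r for every r ∈ (0, r_x). -/

import Mathlib

open MeasureTheory Metric Set
open scoped ENNReal NNReal Topology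

noncomputable section

/-- The tilt function `w_u = (1 - |Du|²)^{-1/2}`. -/
noncomputable def tilt {m : ℕ} (u : EuclideanSpace ℝ (Fin m) → ℝ)
    (x : EuclideanSpace ℝ (Fin m)) : ℝ :=
  (Real.sqrt (1 - ‖gradient u x‖ ^ 2))⁻¹

/-- `div(w_u Du)(x) = Σ_i ∂_i (w_u ∂_i u)(x)`, the Lorentzian mean curvature of the
graph of `u` in Minkowski space. -/
noncomputable def lorentzMeanCurv {m : ℕ} (u : EuclideanSpace ℝ (Fin m) → ℝ)
    (x : EuclideanSpace ℝ (Fin m)) : ℝ :=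
  ∑ i, gradient (fun y => tilt u y * (gradient u y) i) x i

/-- Admissible solution with source `ρ` for the data `(Ω, φ, Λ)`. -/
def IsAdmissible {m : ℕ} (Ω : Set (EuclideanSpace ℝ (Fin m)))
    (φ : EuclideanSpace ℝ (Fin m) → ℝ) (Λ : ℝ)
    (u ρ : EuclideanSpace ℝ (Fin m) → ℝ) : Prop :=
  (∃ V : Set (EuclideanSpace ℝ (Fin m)), IsOpen V ∧ closure Ω ⊆ V ∧ ContDiffOn ℝ (⊤ : ℕ∞) u V) ∧
  (∀ x ∈ closure Ω, ‖gradient u x‖ < 1) ∧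
  (∀ x ∈ frontier Ω, u x = φ x) ∧
  ContinuousOn ρ Ω ∧
  (∀ x ∈ Ω, |lorentzMeanCurv u x - ρ x| ≤ Λ * tilt u x)

open scoped Convolution in
/-- A bounded set carries a smooth compactly supported cutoff that equals `1` at distance more than
`4 / k` from the complement and has gradient at most `k`. -/
theorem exists_contDiff_cutoff {m : ℕ} {Ω : Set (EuclideanSpace ℝ (Fin m))}
    (hΩb : Bornology.IsBounded Ω) {k : ℝ} (hk : 0 < k) :
    ∃ χ : EuclideanSpace ℝ (Fin m) → ℝ, ContDiff ℝ 1 χ ∧ IsCompact (tsupport χ) ∧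
      tsupport χ ⊆ Ω ∧ (∀ y, 0 ≤ χ y) ∧ (∀ y, χ y ≤ 1) ∧ (∀ y, ‖fderiv ℝ χ y‖ ≤ k) ∧
      (∀ y, 4 / k < infDist y Ωᶜ → χ y = 1) ∧
      (∀ y, 4 / k < infDist y Ωᶜ → fderiv ℝ χ y = 0) := by
  set f : EuclideanSpace ℝ (Fin m) → ℝ :=
    fun y => max 0 (min 1 (k * infDist y Ωᶜ - 2)) with hf
  have hf0 : ∀ y, 0 ≤ f y := fun y => le_max_left _ _
  have hf1 : ∀ y, f y ≤ 1 := fun y => max_le zero_le_one (min_le_left _ _)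
  have hfl : ∀ x y, |f x - f y| ≤ k * ‖x - y‖ := by
    intro x y
    have h1 : |infDist x Ωᶜ - infDist y Ωᶜ| ≤ ‖x - y‖ := by
      have := (lipschitz_infDist_pt (Ωᶜ)).dist_le_mul x y
      simpa [Real.dist_eq, dist_eq_norm] using this
    calc |f x - f y| ≤ |min 1 (k * infDist x Ωᶜ - 2) - min 1 (k * infDist y Ωᶜ - 2)| := by
          simpa using abs_max_sub_max_le_max 0 (min 1 (k * infDist x Ωᶜ - 2)) 0
            (min 1 (k * infDist y Ωᶜ - 2))
      _ ≤ |(k * infDist x Ωᶜ - 2) - (k * infDist y Ωᶜ - 2)| := by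
          simpa using abs_min_sub_min_le_max 1 (k * infDist x Ωᶜ - 2) 1 (k * infDist y Ωᶜ - 2)
      _ = k * |infDist x Ωᶜ - infDist y Ωᶜ| := by
          rw [← abs_of_pos hk, ← abs_mul, abs_of_pos hk]; ring_nf
      _ ≤ _ := by gcongr
  have hfc : Continuous f := by
    have := continuous_infDist_pt (Ωᶜ)
    fun_prop
  have hk' : 0 < 1 / k := by positivity
  let b : ContDiffBump (0 : EuclideanSpace ℝ (Fin m)) := ⟨1 / (2 * k), 1 / k, by positivity, by
    rw [div_lt_div_iff₀ (by positivity) hk]; linarith⟩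
  set χ : EuclideanSpace ℝ (Fin m) → ℝ :=
    (b.normed volume ⋆[ContinuousLinearMap.lsmul ℝ ℝ, volume] f) with hχ
  have hbi : ∀ x, Integrable (fun t => b.normed volume t * f (x - t)) := fun x => by
    refine (b.continuous_normed.mul (by fun_prop)).integrable_of_hasCompactSupport ?_
    exact b.hasCompactSupport_normed.mul_right
  have hχe : ∀ x, χ x = ∫ t, b.normed volume t * f (x - t) := fun x => by
    simp [hχ, convolution_def]
  have hχd : ContDiff ℝ 1 χ :=
    b.hasCompactSupport_normed.contDiff_convolution_left _ b.contDiff_normed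
      hfc.locallyIntegrable
  have hb0 : ∀ t, 0 ≤ b.normed volume t := fun t => b.nonneg_normed t
  have hind : ∀ y z, z ∈ ball y b.rOut → |infDist z Ωᶜ - infDist y Ωᶜ| < 1 / k := by
    intro y z hz
    have := (lipschitz_infDist_pt (Ωᶜ)).dist_le_mul z y
    simp only [NNReal.coe_one, one_mul, Real.dist_eq] at this
    exact this.trans_lt hz
  have h1 : ∀ y, 4 / k < infDist y Ωᶜ → χ y = 1 := by
    intro y hy
    have key : ∀ z, |infDist z Ωᶜ - infDist y Ωᶜ| < 1 / k → f z = 1 := by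
      intro z hz
      have h3 : 3 / k < infDist z Ωᶜ := by
        have := (abs_lt.1 hz).1
        have e : 4 / k = 3 / k + 1 / k := by ring
        linarith
      rw [div_lt_iff₀ hk] at h3
      simp only [hf]
      rw [min_eq_left (by linarith)]; simp
    have hyy : f y = 1 := key y (by simpa using hk)
    rw [← hyy]
    exact b.normed_convolution_eq_right fun z hz => by rw [hyy]; exact key z (hind y z hz)
  have hts : tsupport χ ⊆ {y | 1 / k ≤ infDist y Ωᶜ} := by
    refine closure_minimal ?_ (isClosed_le continuous_const (continuous_infDist_pt _))
    intro y hy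
    by_contra hlt
    simp only [mem_ofPred_eq, not_le] at hlt
    apply hy
    have key : ∀ z, |infDist z Ωᶜ - infDist y Ωᶜ| < 1 / k → f z = 0 := by
      intro z hz
      have h3 : infDist z Ωᶜ < 2 / k := by
        have := (abs_lt.1 hz).2
        have e : 2 / k = 1 / k + 1 / k := by ring
        linarith
      rw [lt_div_iff₀ hk] at h3
      simp only [hf]
      exact max_eq_left ((min_le_right _ _).trans (by linarith))
    have hyy : f y = 0 := key y (by simpa using hk)
    rw [← hyy]
    exact b.normed_convolution_eq_right fun z hz => by rw [hyy]; exact key z (hind y z hz)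
  have hsub : tsupport χ ⊆ Ω := by
    intro y hy
    by_contra hn
    have := hts hy
    simp only [mem_ofPred_eq, infDist_zero_of_mem (show y ∈ Ωᶜ from hn)] at this
    linarith
  refine ⟨χ, hχd, Metric.isCompact_of_isClosed_isBounded (isClosed_tsupport _) (hΩb.subset hsub),
    hsub, ?_, ?_, ?_, h1, ?_⟩
  · intro y
    rw [hχe]
    exact integral_nonneg fun t => mul_nonneg (hb0 t) (hf0 _)
  · intro y
    rw [hχe, ← b.integral_normed (μ := volume)]
    exact integral_mono (hbi y) b.integrable_normed
      fun t => mul_le_of_le_one_right (hb0 t) (hf1 _)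
  · intro y
    have hl : LipschitzWith ⟨k, hk.le⟩ χ := by
      refine LipschitzWith.of_dist_le_mul fun x y => ?_
      rw [Real.dist_eq, hχe, hχe, ← integral_sub (hbi x) (hbi y)]
      calc |∫ t, (b.normed volume t * f (x - t) - b.normed volume t * f (y - t))|
          ≤ ∫ t, b.normed volume t * (k * ‖x - y‖) := by
            rw [← Real.norm_eq_abs]
            refine norm_integral_le_of_norm_le (b.integrable_normed.mul_const _) ?_
            refine Filter.Eventually.of_forall fun t => ?_
            rw [← mul_sub, norm_mul, Real.norm_of_nonneg (hb0 t)]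
            refine mul_le_mul_of_nonneg_left ?_ (hb0 t)
            simpa using hfl (x - t) (y - t)
        _ = k * dist x y := by
            rw [integral_mul_const, b.integral_normed, one_mul, dist_eq_norm]
    exact norm_fderiv_le_of_lipschitz ℝ hl
  · intro y hy
    have : χ =ᶠ[𝓝 y] fun _ => (1 : ℝ) := by
      filter_upwards [(isOpen_lt continuous_const (continuous_infDist_pt (Ωᶜ))).mem_nhds hy]
        with z hz using h1 z hz
    rw [this.fderiv_eq]; simp

theorem integral_tsupport_fderiv_mul_add_eq_zero {E : Type*} [NormedAddCommGroup E]
    [NormedSpace ℝ E] [FiniteDimensional ℝ E] [MeasurableSpace E] [BorelSpace E]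
    (μ : Measure E) [μ.IsAddHaarMeasure] {Ω : Set E} (hΩ : IsOpen Ω)
    {P χ : E → ℝ} (hP : ContDiffOn ℝ 1 P Ω) (hχ : ContDiff ℝ 1 χ)
    (hc : IsCompact (tsupport χ)) (hs : tsupport χ ⊆ Ω) (e : E) :
    IntegrableOn (fun x => χ x * fderiv ℝ P x e + P x * fderiv ℝ χ x e) (tsupport χ) μ ∧
    ∫ x in tsupport χ, (χ x * fderiv ℝ P x e + P x * fderiv ℝ χ x e) ∂μ = 0 := by
  have hPc : ContinuousOn P (tsupport χ) := hP.continuousOn.mono hs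
  have hP'c : ContinuousOn (fun x => fderiv ℝ P x e) (tsupport χ) :=
    ((hP.continuousOn_fderiv_of_isOpen hΩ le_rfl).mono hs).clm_apply continuousOn_const
  have hχ'c : Continuous (fun x => fderiv ℝ χ x e) :=
    (hχ.continuous_fderiv one_ne_zero).clm_apply continuous_const
  have hχ0 : ∀ x, x ∉ tsupport χ → χ x = 0 := fun x hx => image_eq_zero_of_notMem_tsupport hx
  have hχ'0 : ∀ x, x ∉ tsupport χ → fderiv ℝ χ x = 0 := fun x hx =>
    image_eq_zero_of_notMem_tsupport fun h => hx (tsupport_fderiv_subset ℝ h)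
  have h0 : ∀ x, x ∉ tsupport χ → χ x * fderiv ℝ P x e + P x * fderiv ℝ χ x e = 0 := by
    intro x hx
    simp [hχ0 x hx, hχ'0 x hx]
  have hon : IntegrableOn (fun x => χ x * fderiv ℝ P x e + P x * fderiv ℝ χ x e)
      (tsupport χ) μ := by
    refine ContinuousOn.integrableOn_compact hc ?_
    exact (hχ.continuous.continuousOn.mul hP'c).add (hPc.mul hχ'c.continuousOn)
  have hi : Integrable (fun x => χ x * fderiv ℝ P x e + P x * fderiv ℝ χ x e) μ := by
    rwa [← integrableOn_iff_integrable_of_support_subset (s := tsupport χ)]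
    intro x hx
    by_contra hn
    exact hx (h0 x hn)
  have hi' : Integrable (fun x => χ x * P x) μ := by
    rw [← integrableOn_iff_integrable_of_support_subset (s := tsupport χ)]
    · exact (hχ.continuous.continuousOn.mul hPc).integrableOn_compact hc
    · intro x hx
      by_contra hn
      exact hx (by simp [hχ0 x hn])
  refine ⟨hon, ?_⟩
  rw [setIntegral_eq_integral_of_forall_compl_eq_zero h0]
  have hd : ∀ x, HasFDerivAt (fun x => χ x * P x) (χ x • fderiv ℝ P x + P x • fderiv ℝ χ x) x := by
    intro x
    by_cases hx : x ∈ tsupport χ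
    · exact ((hχ.differentiable one_ne_zero) x).hasFDerivAt.mul
        ((hP.differentiableOn one_ne_zero).differentiableAt
          (hΩ.mem_nhds (hs hx))).hasFDerivAt
    · rw [hχ0 x hx, hχ'0 x hx]
      simp only [zero_smul, smul_zero, add_zero]
      refine (hasFDerivAt_const (0 : ℝ) x).congr_of_eventuallyEq ?_
      filter_upwards [(isClosed_tsupport χ).isOpen_compl.mem_nhds hx] with y hy
      simp [hχ0 y hy]
  have := integral_bilinear_hasFDerivAt_right_eq_neg_left_of_integrable (μ := μ)
    (B := ContinuousLinearMap.mul ℝ ℝ) (f := fun x => χ x * P x)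
    (f' := fun x => χ x • fderiv ℝ P x + P x • fderiv ℝ χ x) (g := fun _ => (1 : ℝ))
    (g' := fun _ => 0) (v := e) (by simpa using hi) (by simp) (by simpa using hi')
    (fun x _ => hd x) (fun x _ => hasFDerivAt_const _ _)
  simpa using this.symm

theorem gradient_apply_eq_fderiv {m : ℕ} (f : EuclideanSpace ℝ (Fin m) → ℝ)
    (x : EuclideanSpace ℝ (Fin m)) (i : Fin m) :
    gradient f x i = fderiv ℝ f x (EuclideanSpace.single i 1) := by
  rw [← inner_gradient_left, EuclideanSpace.inner_single_right]
  simp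

theorem sum_apply_mul_single {m : ℕ} (L : EuclideanSpace ℝ (Fin m) →L[ℝ] ℝ)
    (q : EuclideanSpace ℝ (Fin m)) : ∑ i, q i * L (EuclideanSpace.single i 1) = L q := by
  conv_rhs => rw [← (EuclideanSpace.basisFun (Fin m) ℝ).sum_repr q]
  simp [map_sum]

theorem norm_gradient_eq {m : ℕ} (f : EuclideanSpace ℝ (Fin m) → ℝ)
    (x : EuclideanSpace ℝ (Fin m)) : ‖gradient f x‖ = ‖fderiv ℝ f x‖ := by
  simp [gradient]

theorem ContDiffOn.gradient_of_isOpen {m : ℕ} {U : Set (EuclideanSpace ℝ (Fin m))} (hU : IsOpen U)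
    {u : EuclideanSpace ℝ (Fin m) → ℝ} (hu : ContDiffOn ℝ 2 u U) :
    ContDiffOn ℝ 1 (gradient u) U := by
  have h := hu.fderiv_of_isOpen hU (m := 1) (by norm_num)
  exact (InnerProductSpace.toDual ℝ (EuclideanSpace ℝ (Fin m))).symm.contDiff.comp_contDiffOn h

theorem contDiffOn_tilt {m : ℕ} {U : Set (EuclideanSpace ℝ (Fin m))} (hU : IsOpen U)
    {u : EuclideanSpace ℝ (Fin m) → ℝ} (hu : ContDiffOn ℝ 2 u U)
    (hu1 : ∀ x ∈ U, ‖gradient u x‖ < 1) : ContDiffOn ℝ 1 (tilt u) U := by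
  have hpos : ∀ x ∈ U, 0 < 1 - ‖gradient u x‖ ^ 2 := fun x hx => by
    have := hu1 x hx
    have := norm_nonneg (gradient u x)
    nlinarith
  refine ContDiffOn.inv (ContDiffOn.sqrt ?_ fun x hx => (hpos x hx).ne')
    fun x hx => (Real.sqrt_pos.2 (hpos x hx)).ne'
  exact contDiffOn_const.sub ((ContDiffOn.gradient_of_isOpen hU hu).norm_sq ℝ)

/-- Weak form of the Lorentzian mean curvature operator. -/
theorem integral_lorentzMeanCurv_weak {m : ℕ} {Ω : Set (EuclideanSpace ℝ (Fin m))}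
    (hΩ : IsOpen Ω) {u v χ : EuclideanSpace ℝ (Fin m) → ℝ} (hu : ContDiffOn ℝ 2 u Ω)
    (hu1 : ∀ x ∈ Ω, ‖gradient u x‖ < 1) (hv : ContDiffOn ℝ 1 v Ω)
    {g g' : ℝ → ℝ} (hg : ∀ s, HasDerivAt g (g' s) s) (hg' : Continuous g')
    (hχ : ContDiff ℝ 1 χ) (hc : IsCompact (tsupport χ)) (hs : tsupport χ ⊆ Ω) :
    IntegrableOn (fun x => (g (v x) * (tilt u x * fderiv ℝ χ x (gradient u x)) +
      χ x * (g' (v x) * (tilt u x * fderiv ℝ v x (gradient u x))) +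
      χ x * (g (v x) * lorentzMeanCurv u x))) (tsupport χ) ∧
    ∫ x in tsupport χ, (g (v x) * (tilt u x * fderiv ℝ χ x (gradient u x)) +
      χ x * (g' (v x) * (tilt u x * fderiv ℝ v x (gradient u x))) +
      χ x * (g (v x) * lorentzMeanCurv u x)) = 0 := by
  have hX : ∀ i, ContDiffOn ℝ 1 (fun y => tilt u y * gradient u y i) Ω := fun i =>
    (contDiffOn_tilt hΩ hu hu1).mul
      ((EuclideanSpace.proj (𝕜 := ℝ) i).contDiff.comp_contDiffOn
        (ContDiffOn.gradient_of_isOpen hΩ hu))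
  have hgd : ContDiff ℝ 1 g := by
    rw [contDiff_one_iff_deriv]
    exact ⟨fun s => (hg s).differentiableAt, by rwa [funext fun s => (hg s).deriv]⟩
  have hgv : ContDiffOn ℝ 1 (fun y => g (v y)) Ω := hgd.comp_contDiffOn hv
  have key := fun i => integral_tsupport_fderiv_mul_add_eq_zero volume hΩ (hgv.mul (hX i)) hχ hc hs
    (EuclideanSpace.single i 1)
  have hint := integrable_finsetSum Finset.univ (fun i _ => (key i).1)
  have hsum := integral_finsetSum Finset.univ (fun i _ => (key i).1)
  rw [Finset.sum_eq_zero fun i _ => (key i).2] at hsum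
  have hcongr : EqOn (fun x => (g (v x) * (tilt u x * fderiv ℝ χ x (gradient u x)) +
      χ x * (g' (v x) * (tilt u x * fderiv ℝ v x (gradient u x))) +
      χ x * (g (v x) * lorentzMeanCurv u x)))
      (fun x => ∑ i, (χ x * fderiv ℝ (fun y => g (v y) * (tilt u y * gradient u y i)) x
        (EuclideanSpace.single i 1) + g (v x) * (tilt u x * gradient u x i) *
          fderiv ℝ χ x (EuclideanSpace.single i 1))) (tsupport χ) := by
    intro x hx
    have hxΩ := hΩ.mem_nhds (hs hx)
    have hvx : HasFDerivAt (fun y => g (v y)) (g' (v x) • fderiv ℝ v x) x :=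
      (hg (v x)).comp_hasFDerivAt x
        ((hv.differentiableOn one_ne_zero).differentiableAt hxΩ).hasFDerivAt
    have hXx := fun i => (((hX i).differentiableOn one_ne_zero).differentiableAt hxΩ).hasFDerivAt
    have e : ∀ i, fderiv ℝ (fun y => g (v y) * (tilt u y * gradient u y i)) x
        (EuclideanSpace.single i 1) = g (v x) * gradient (fun y => tilt u y * gradient u y i) x i
          + (tilt u x * gradient u x i) * (g' (v x) * fderiv ℝ v x (EuclideanSpace.single i 1)) := by
      intro i
      rw [(hvx.fun_mul (hXx i)).fderiv,
        gradient_apply_eq_fderiv (fun y => tilt u y * gradient u y i)]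
      simp only [add_apply, smul_apply, smul_eq_mul, mul_assoc]
    simp only [lorentzMeanCurv]
    rw [← sum_apply_mul_single (fderiv ℝ χ x), ← sum_apply_mul_single (fderiv ℝ v x)]
    simp only [Finset.mul_sum, ← Finset.sum_add_distrib]
    refine Finset.sum_congr rfl fun i _ => ?_
    rw [e i]
    ring
  exact ⟨IntegrableOn.congr_fun hint hcongr.symm (isClosed_tsupport χ).measurableSet,
    (setIntegral_congr_fun (isClosed_tsupport χ).measurableSet hcongr).trans hsum⟩

theorem tilt_nonneg {m : ℕ} (u : EuclideanSpace ℝ (Fin m) → ℝ) (x : EuclideanSpace ℝ (Fin m)) :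
    0 ≤ tilt u x := inv_nonneg.2 (Real.sqrt_nonneg _)

/-- Energy inequality obtained by testing the mean curvature equation with `χ g(v)`. -/
theorem energy_inequality {m : ℕ} {Ω : Set (EuclideanSpace ℝ (Fin m))}
    (hΩ : IsOpen Ω) {u v χ ρ : EuclideanSpace ℝ (Fin m) → ℝ} (hu : ContDiffOn ℝ 2 u Ω)
    (hu1 : ∀ x ∈ Ω, ‖gradient u x‖ < 1) (hv : ContDiffOn ℝ 1 v Ω)
    {g g' : ℝ → ℝ} (hg : ∀ s, HasDerivAt g (g' s) s) (hg' : Continuous g')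
    (hχ : ContDiff ℝ 1 χ) (hc : IsCompact (tsupport χ)) (hs : tsupport χ ⊆ Ω)
    (hχ0 : ∀ x, 0 ≤ χ x) {Λ : ℝ} (hρ : ContinuousOn ρ Ω)
    (hH : ∀ x ∈ Ω, |lorentzMeanCurv u x - ρ x| ≤ Λ * tilt u x) :
    IntegrableOn (fun x => χ x * (g' (v x) * (tilt u x * fderiv ℝ v x (gradient u x))) -
      (|g (v x)| * (tilt u x * ‖fderiv ℝ χ x‖) + χ x * (|g (v x)| * (|ρ x| + Λ * tilt u x))))
      (tsupport χ) ∧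
    ∫ x in tsupport χ, (χ x * (g' (v x) * (tilt u x * fderiv ℝ v x (gradient u x))) -
      (|g (v x)| * (tilt u x * ‖fderiv ℝ χ x‖) +
        χ x * (|g (v x)| * (|ρ x| + Λ * tilt u x)))) ≤ 0 := by
  obtain ⟨hi, h0⟩ := integral_lorentzMeanCurv_weak hΩ hu hu1 hv hg hg' hχ hc hs
  have hgc : Continuous g := continuous_iff_continuousAt.2 fun s => (hg s).continuousAt
  have c1 : ContinuousOn (fun x => g (v x)) (tsupport χ) :=
    hgc.comp_continuousOn (hv.continuousOn.mono hs)
  have c2 : ContinuousOn (fun x => g' (v x)) (tsupport χ) :=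
    hg'.comp_continuousOn (hv.continuousOn.mono hs)
  have c3 : ContinuousOn (tilt u) (tsupport χ) := (contDiffOn_tilt hΩ hu hu1).continuousOn.mono hs
  have c4 : ContinuousOn (gradient u) (tsupport χ) :=
    (ContDiffOn.gradient_of_isOpen hΩ hu).continuousOn.mono hs
  have c5 : ContinuousOn (fun x => fderiv ℝ v x (gradient u x)) (tsupport χ) :=
    ((hv.continuousOn_fderiv_of_isOpen hΩ le_rfl).mono hs).clm_apply c4
  have c6 : ContinuousOn (fun x => ‖fderiv ℝ χ x‖) (tsupport χ) :=
    (hχ.continuous_fderiv one_ne_zero).norm.continuousOn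
  have c7 : ContinuousOn χ (tsupport χ) := hχ.continuous.continuousOn
  have c8 : ContinuousOn ρ (tsupport χ) := hρ.mono hs
  have hB : IntegrableOn (fun x => χ x * (g' (v x) * (tilt u x * fderiv ℝ v x (gradient u x))) -
      (|g (v x)| * (tilt u x * ‖fderiv ℝ χ x‖) + χ x * (|g (v x)| * (|ρ x| + Λ * tilt u x))))
      (tsupport χ) := by
    refine ContinuousOn.integrableOn_compact hc ?_
    exact (c7.mul (c2.mul (c3.mul c5))).sub ((c1.abs.mul (c3.mul c6)).add
      (c7.mul (c1.abs.mul (c8.abs.add (continuousOn_const.mul c3)))))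
  refine ⟨hB, ?_⟩
  rw [← h0]
  refine setIntegral_mono_on hB hi (isClosed_tsupport χ).measurableSet fun x hx => ?_
  have hxΩ := hs hx
  have hw := tilt_nonneg u x
  have h1 : |g (v x) * (tilt u x * fderiv ℝ χ x (gradient u x))| ≤
      |g (v x)| * (tilt u x * ‖fderiv ℝ χ x‖) := by
    rw [abs_mul, abs_mul, abs_of_nonneg hw]
    gcongr
    calc |fderiv ℝ χ x (gradient u x)| ≤ ‖fderiv ℝ χ x‖ * ‖gradient u x‖ :=
          (fderiv ℝ χ x).le_opNorm _
      _ ≤ ‖fderiv ℝ χ x‖ := mul_le_of_le_one_right (norm_nonneg _) (hu1 x hxΩ).le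
  have h2 : |χ x * (g (v x) * lorentzMeanCurv u x)| ≤
      χ x * (|g (v x)| * (|ρ x| + Λ * tilt u x)) := by
    rw [abs_mul, abs_mul, abs_of_nonneg (hχ0 x)]
    have h3 : |lorentzMeanCurv u x| ≤ |ρ x| + Λ * tilt u x := by
      have := hH x hxΩ
      have := abs_add_le (ρ x) (lorentzMeanCurv u x - ρ x)
      rw [add_sub_cancel] at this
      linarith
    have := hχ0 x
    gcongr
  have := (abs_le.1 h1).1
  have := (abs_le.1 h2).1
  linarith

theorem tilt_coercive {θ a : ℝ} (hθ : θ ∈ Ioo (0 : ℝ) (1 / 4)) (ha0 : 0 ≤ a) (ha1 : a < 1) :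
    θ * (√(1 - a ^ 2))⁻¹ - 2 * (√(1 - (1 - 2 * θ) ^ 2))⁻¹ ≤
      (√(1 - a ^ 2))⁻¹ * (a ^ 2 - (1 - 4 * θ) * a) := by
  obtain ⟨h0, h1⟩ := hθ
  have hw : 0 ≤ (√(1 - a ^ 2))⁻¹ := by positivity
  have hw0 : 0 ≤ (√(1 - (1 - 2 * θ) ^ 2))⁻¹ := by positivity
  rcases le_total (1 - 2 * θ) a with h | h
  · have : θ ≤ a ^ 2 - (1 - 4 * θ) * a := by nlinarith
    nlinarith [mul_le_mul_of_nonneg_left this hw]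
  · have h2 : (√(1 - a ^ 2))⁻¹ ≤ (√(1 - (1 - 2 * θ) ^ 2))⁻¹ := by
      refine inv_anti₀ (Real.sqrt_pos.2 (by nlinarith)) (Real.sqrt_le_sqrt ?_)
      nlinarith
    have : -2 ≤ a ^ 2 - (1 - 4 * θ) * a - θ := by nlinarith
    nlinarith [mul_le_mul_of_nonneg_left this hw]

theorem abs_le_mul_infDist_compl {E : Type*} [NormedAddCommGroup E]
    [NormedSpace ℝ E] [FiniteDimensional ℝ E] {Ω : Set E} (hne : Ω ≠ univ)
    {v : E → ℝ} {L : ℝ} (hv : ∀ x ∈ closure Ω, DifferentiableAt ℝ v x)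
    (hvL : ∀ x ∈ closure Ω, ‖fderiv ℝ v x‖ ≤ L) (hv0 : ∀ x ∈ frontier Ω, v x = 0)
    {y : E} (hy : y ∈ Ω) : |v y| ≤ L * infDist y Ωᶜ := by
  have hsub := closedBall_infDist_compl_subset_closure hy
  obtain ⟨z, hz, hyz⟩ := exists_mem_frontier_infDist_compl_eq_dist hy hne
  have := (convex_closedBall y (infDist y Ωᶜ)).norm_image_sub_le_of_norm_fderiv_le
    (fun x hx => hv x (hsub hx)) (fun x hx => hvL x (hsub hx))
    (show z ∈ _ by rw [mem_closedBall, dist_comm, hyz]) (mem_closedBall_self infDist_nonneg)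
  rwa [hv0 z hz, sub_zero, Real.norm_eq_abs, ← dist_eq_norm, ← hyz] at this

theorem abs_sinh_le_mul_cosh {t M : ℝ} (ht : |t| ≤ M) : |Real.sinh t| ≤ Real.cosh M * |t| := by
  have hM : 0 ≤ M := (abs_nonneg t).trans ht
  have := (convex_closedBall (0 : ℝ) M).norm_image_sub_le_of_norm_deriv_le
    (f := Real.sinh) (C := Real.cosh M) (fun x _ => Real.differentiable_sinh x)
    (fun x hx => by
      rw [Real.deriv_sinh, Real.norm_of_nonneg (Real.cosh_pos _).le, Real.cosh_le_cosh,
        abs_of_nonneg hM]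
      simpa using hx)
    (mem_closedBall_self hM) (show t ∈ _ by simpa using ht)
  simpa using this

theorem integrableOn_tilt {m : ℕ} {Ω U : Set (EuclideanSpace ℝ (Fin m))}
    (hΩb : Bornology.IsBounded Ω) (hU : IsOpen U) (hΩU : closure Ω ⊆ U)
    {u : EuclideanSpace ℝ (Fin m) → ℝ} (hu : ContDiffOn ℝ 2 u U)
    (hu1 : ∀ x ∈ U, ‖gradient u x‖ < 1) : IntegrableOn (tilt u) Ω :=
  (((contDiffOn_tilt hU hu hu1).continuousOn.mono hΩU).integrableOn_compact
    hΩb.isCompact_closure).mono_set subset_closure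

/-- Global bound for the mass of the tilt function. -/
theorem integral_tilt_le {m : ℕ} {Ω U : Set (EuclideanSpace ℝ (Fin m))} (hΩ : IsOpen Ω)
    (hΩb : Bornology.IsBounded Ω) (hne : Ω ≠ univ) (hU : IsOpen U) (hΩU : closure Ω ⊆ U)
    {u φ ρ : EuclideanSpace ℝ (Fin m) → ℝ} (hu : ContDiffOn ℝ 2 u U)
    (hu1 : ∀ x ∈ U, ‖gradient u x‖ < 1) {θ : ℝ} (hθ : θ ∈ Ioo (0 : ℝ) (1 / 4))
    (hφ : ContDiff ℝ 1 φ) (hφg : ∀ x ∈ closure Ω, ‖gradient φ x‖ ≤ 1 - 4 * θ)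
    (huφ : ∀ x ∈ frontier Ω, u x = φ x) {Λ : ℝ} (hΛ : 0 ≤ Λ) (hρ : ContinuousOn ρ Ω)
    (hρi : IntegrableOn (fun x => |ρ x|) Ω)
    (hH : ∀ x ∈ Ω, |lorentzMeanCurv u x - ρ x| ≤ Λ * tilt u x) :
    ∫ x in Ω, tilt u x ≤ Real.cosh ((Λ + 1) / θ * (2 * diam Ω)) * (∫ x in Ω, |ρ x|) +
      2 * (√(1 - (1 - 2 * θ) ^ 2))⁻¹ * ((Λ + 1) / θ) *
        Real.cosh ((Λ + 1) / θ * (2 * diam Ω)) * volume.real Ω := by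
  have hθ0 := hθ.1
  set κ := (Λ + 1) / θ with hκ
  have hκ0 : 0 < κ := by positivity
  have hκθ : κ * θ = Λ + 1 := by rw [hκ]; field_simp
  set M := κ * (2 * diam Ω) with hM
  set G := Real.cosh M with hG
  have hG0 : 0 < G := Real.cosh_pos _
  set C₀ := 2 * (√(1 - (1 - 2 * θ) ^ 2))⁻¹ with hC₀
  have hC₀0 : 0 ≤ C₀ := by positivity
  have huΩ : ContDiffOn ℝ 2 u Ω := hu.mono (subset_closure.trans hΩU)
  have hu1Ω : ∀ x ∈ Ω, ‖gradient u x‖ < 1 := fun x hx => hu1 x (hΩU (subset_closure hx))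
  have hwi := integrableOn_tilt hΩb hU hΩU hu hu1
  have hud : ∀ x ∈ closure Ω, DifferentiableAt ℝ u x := fun x hx =>
    (hu.differentiableOn two_ne_zero).differentiableAt (hU.mem_nhds (hΩU hx))
  have hφd : ∀ x, DifferentiableAt ℝ φ x := fun x => hφ.differentiable one_ne_zero x
  set v : EuclideanSpace ℝ (Fin m) → ℝ := fun x => u x - φ x with hv
  have hvc : ContDiffOn ℝ 1 v Ω := (huΩ.of_le (by norm_num)).sub hφ.contDiffOn
  have hvf : ∀ x ∈ closure Ω, fderiv ℝ v x = fderiv ℝ u x - fderiv ℝ φ x := fun x hx =>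
    fderiv_fun_sub (hud x hx) (hφd x)
  have hvd : ∀ x ∈ Ω, |v x| ≤ 2 * infDist x Ωᶜ := by
    intro x hx
    refine abs_le_mul_infDist_compl (v := v) hne (fun x hx => (hud x hx).sub (hφd x)) ?_ ?_ hx
    · intro x hx
      rw [hvf x hx]
      have h1 := hu1 x (hΩU hx)
      have h2 := hφg x hx
      rw [norm_gradient_eq] at h1 h2
      have := norm_sub_le (fderiv ℝ u x) (fderiv ℝ φ x)
      linarith
    · intro x hx
      simp [v, huφ x hx]
  have hdist : ∀ x ∈ Ω, infDist x Ωᶜ ≤ diam Ω := by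
    intro x hx
    obtain ⟨z, hz, hxz⟩ := exists_mem_frontier_infDist_compl_eq_dist hx hne
    rw [hxz, ← diam_closure]
    exact dist_le_diam_of_mem hΩb.closure (subset_closure hx) hz.1
  have hvM : ∀ x ∈ Ω, |κ * v x| ≤ M := by
    intro x hx
    rw [abs_mul, abs_of_pos hκ0]
    have := hvd x hx
    have := hdist x hx
    rw [hM]
    gcongr
    linarith
  have hcosh : ∀ x ∈ Ω, Real.cosh (κ * v x) ≤ G := by
    intro x hx
    rw [hG, Real.cosh_le_cosh]
    exact (hvM x hx).trans (le_abs_self _)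
  have hsc : ∀ t, |Real.sinh t| ≤ Real.cosh t := fun t => by
    rw [Real.abs_sinh, ← Real.cosh_abs]
    exact (Real.sinh_lt_cosh _).le
  have hg : ∀ s, HasDerivAt (fun s => Real.sinh (κ * s)) (κ * Real.cosh (κ * s)) s := fun s => by
    have := ((hasDerivAt_id s).const_mul κ).sinh
    simpa [mul_comm] using this
  have hco : ∀ x ∈ Ω, θ * tilt u x - C₀ ≤ tilt u x * fderiv ℝ v x (gradient u x) := by
    intro x hx
    have hxc := subset_closure hx
    refine (tilt_coercive hθ (norm_nonneg (gradient u x)) (hu1Ω x hx)).trans ?_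
    change tilt u x * _ ≤ _
    refine mul_le_mul_of_nonneg_left ?_ (tilt_nonneg u x)
    rw [hvf x hxc, sub_apply, ← inner_gradient_left,
      real_inner_self_eq_norm_sq]
    have h1 : fderiv ℝ φ x (gradient u x) ≤ ‖fderiv ℝ φ x‖ * ‖gradient u x‖ :=
      (le_abs_self _).trans ((fderiv ℝ φ x).le_opNorm _)
    have h2 := hφg x hxc
    rw [norm_gradient_eq] at h2
    have := mul_le_mul_of_nonneg_right h2 (norm_nonneg (gradient u x))
    linarith
  set S : ℕ → Set (EuclideanSpace ℝ (Fin m)) :=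
    fun n => Ω ∩ {y | infDist y Ωᶜ ≤ 4 / ((n : ℝ) + 1)} with hS
  have hSm : ∀ n, MeasurableSet (S n) := fun n =>
    hΩ.measurableSet.inter (isClosed_le (continuous_infDist_pt _) continuous_const).measurableSet
  set c := G * κ * 8 with hcdef
  have hstep : ∀ n, ∫ x in Ω, tilt u x ≤ (G * (∫ x in Ω, |ρ x|) + C₀ * κ * G * volume.real Ω) +
      (1 + c) * ∫ x in S n, tilt u x := by
    intro n
    have hk : (0 : ℝ) < (n : ℝ) + 1 := by positivity
    obtain ⟨χ, hχ, hc, hs, hχ0, hχ1, hχL, hχe, hχ'e⟩ := exists_contDiff_cutoff hΩb hk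
    obtain ⟨hBi, hB⟩ := energy_inequality hΩ huΩ hu1Ω hvc hg (by fun_prop) hχ hc hs hχ0 hρ hH
    have hKm : MeasurableSet (tsupport χ) := (isClosed_tsupport χ).measurableSet
    have hind : IntegrableOn ((S n).indicator (fun x => c * tilt u x)) Ω :=
      (hwi.const_mul c).indicator (hSm n)
    have hci : IntegrableOn (fun _ : EuclideanSpace ℝ (Fin m) => C₀ * κ * G) Ω :=
      integrableOn_const hΩb.measure_lt_top.ne
    have hRi : IntegrableOn (fun x => (S n).indicator (fun x => c * tilt u x) x +
        (G * |ρ x| + C₀ * κ * G)) Ω := hind.add ((hρi.const_mul G).add hci)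
    have hχw : IntegrableOn (fun x => χ x * tilt u x) (tsupport χ) :=
      (hχ.continuous.continuousOn.mul
        ((contDiffOn_tilt hΩ huΩ hu1Ω).continuousOn.mono hs)).integrableOn_compact hc
    have hpt : ∀ x ∈ tsupport χ, χ x * tilt u x ≤
        (χ x * (κ * Real.cosh (κ * v x) * (tilt u x * fderiv ℝ v x (gradient u x))) -
          (|Real.sinh (κ * v x)| * (tilt u x * ‖fderiv ℝ χ x‖) +
          χ x * (|Real.sinh (κ * v x)| * (|ρ x| + Λ * tilt u x)))) +
        ((S n).indicator (fun x => c * tilt u x) x + (G * |ρ x| + C₀ * κ * G)) := by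
      intro x hx
      have hxΩ := hs hx
      have hw := tilt_nonneg u x
      have h1 : |Real.sinh (κ * v x)| * (tilt u x * ‖fderiv ℝ χ x‖) ≤
          (S n).indicator (fun x => c * tilt u x) x := by
        by_cases hxS : infDist x Ωᶜ ≤ 4 / ((n : ℝ) + 1)
        · rw [indicator_of_mem (show x ∈ S n from ⟨hxΩ, hxS⟩)]
          have h2 : |Real.sinh (κ * v x)| ≤ G * (κ * (2 * (4 / ((n : ℝ) + 1)))) := by
            refine (abs_sinh_le_mul_cosh (hvM x hxΩ)).trans ?_
            rw [abs_mul, abs_of_pos hκ0]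
            have := hvd x hxΩ
            gcongr
            linarith
          calc |Real.sinh (κ * v x)| * (tilt u x * ‖fderiv ℝ χ x‖)
              ≤ (G * (κ * (2 * (4 / ((n : ℝ) + 1))))) * (tilt u x * ((n : ℝ) + 1)) := by
                gcongr
                exact hχL x
            _ = c * tilt u x := by rw [hcdef]; field_simp; ring
        · rw [hχ'e x (not_le.1 hxS), norm_zero, mul_zero, mul_zero]
          exact indicator_nonneg (fun y _ => by have := tilt_nonneg u y; positivity) x
      have h3 := hsc (κ * v x)
      have h4 := hcosh x hxΩ
      have hcp := Real.cosh_pos (κ * v x)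
      have h5 : χ x * (|Real.sinh (κ * v x)| * |ρ x|) ≤ G * |ρ x| := by
        calc χ x * (|Real.sinh (κ * v x)| * |ρ x|) ≤ 1 * (G * |ρ x|) := by
              gcongr
              · exact hχ1 x
              · exact h3.trans h4
          _ = _ := one_mul _
      have h6 : tilt u x ≤ κ * Real.cosh (κ * v x) * (tilt u x * fderiv ℝ v x (gradient u x)) -
          |Real.sinh (κ * v x)| * (Λ * tilt u x) + C₀ * κ * G := by
        have a1 := mul_le_mul_of_nonneg_left (hco x hxΩ) (mul_pos hκ0 hcp).le
        have a2 : |Real.sinh (κ * v x)| * (Λ * tilt u x) ≤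
            Real.cosh (κ * v x) * (Λ * tilt u x) := by gcongr
        have a3 : κ * Real.cosh (κ * v x) * (θ * tilt u x - C₀) =
            Real.cosh (κ * v x) * ((Λ + 1) * tilt u x) - C₀ * κ * Real.cosh (κ * v x) := by
          rw [← hκθ]; ring
        have a4 : C₀ * κ * Real.cosh (κ * v x) ≤ C₀ * κ * G := by gcongr
        have a5 := mul_le_mul_of_nonneg_right (Real.one_le_cosh (κ * v x)) hw
        linarith
      have h7 := mul_le_mul_of_nonneg_left h6 (hχ0 x)
      have h8 : χ x * (C₀ * κ * G) ≤ C₀ * κ * G :=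
        mul_le_of_le_one_left (by positivity) (hχ1 x)
      linarith
    have hRn : ∀ x, 0 ≤ (S n).indicator (fun x => c * tilt u x) x +
        (G * |ρ x| + C₀ * κ * G) := by
      intro x
      have : 0 ≤ (S n).indicator (fun x => c * tilt u x) x :=
        indicator_nonneg (fun y _ => by have := tilt_nonneg u y; positivity) x
      positivity
    have hR : ∫ x in Ω, ((S n).indicator (fun x => c * tilt u x) x +
        (G * |ρ x| + C₀ * κ * G)) = c * (∫ x in S n, tilt u x) +
          (G * (∫ x in Ω, |ρ x|) + C₀ * κ * G * volume.real Ω) := by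
      have e1 := integral_add hind ((hρi.const_mul G).add hci)
      have e2 := integral_add (hρi.const_mul G) hci
      simp only [Pi.add_apply] at e1
      rw [e1, e2, setIntegral_indicator (hSm n), inter_eq_right.2 inter_subset_left,
        integral_const_mul, integral_const_mul, setIntegral_const, smul_eq_mul,
        mul_comm (volume.real Ω)]
    have hmain : ∫ x in tsupport χ, χ x * tilt u x ≤ c * (∫ x in S n, tilt u x) +
          (G * (∫ x in Ω, |ρ x|) + C₀ * κ * G * volume.real Ω) := by
      rw [← hR]
      refine (setIntegral_mono_on hχw (hBi.add (hRi.mono_set hs)) hKm hpt).trans ?_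
      simp only [Pi.add_apply]
      rw [integral_add hBi (hRi.mono_set hs)]
      have := setIntegral_mono_set hRi (Filter.Eventually.of_forall hRn)
        (LE.le.eventuallyLE hs)
      linarith
    have hdiff : ∫ x in Ω \ S n, tilt u x ≤ ∫ x in tsupport χ, χ x * tilt u x := by
      have hone : ∀ x ∈ Ω \ S n, χ x = 1 := fun x hx =>
        hχe x (not_le.1 fun h => hx.2 ⟨hx.1, h⟩)
      have hsub : Ω \ S n ⊆ tsupport χ := fun x hx =>
        subset_tsupport χ (by simp [hone x hx])
      calc ∫ x in Ω \ S n, tilt u x = ∫ x in Ω \ S n, χ x * tilt u x :=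
            setIntegral_congr_fun (hΩ.measurableSet.diff (hSm n)) fun x hx => by
              simp [hone x hx]
        _ ≤ _ := setIntegral_mono_set hχw
            (Filter.Eventually.of_forall fun x => mul_nonneg (hχ0 x) (tilt_nonneg u x))
            (LE.le.eventuallyLE hsub)
    have hsplit := integral_inter_add_sdiff (hSm n) hwi
    rw [inter_eq_right.2 (show S n ⊆ Ω from inter_subset_left)] at hsplit
    linarith
  have hlim : Filter.Tendsto (fun n => ∫ x in S n, tilt u x) Filter.atTop (𝓝 0) := by
    have hanti : Antitone S := by
      intro a b hab x hx
      refine ⟨hx.1, le_trans (show infDist x Ωᶜ ≤ 4 / ((b : ℝ) + 1) from hx.2) ?_⟩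
      have : (a : ℝ) ≤ b := by exact_mod_cast hab
      gcongr
    have := tendsto_setIntegral_of_antitone hSm hanti ⟨0, hwi.mono_set inter_subset_left⟩
    have hempty : ⋂ n, S n = ∅ := by
      rw [eq_empty_iff_forall_notMem]
      intro x hx
      rw [mem_iInter] at hx
      have hxΩ := (hx 0).1
      have hpos : 0 < infDist x Ωᶜ := by
        rw [← hΩ.isClosed_compl.notMem_iff_infDist_pos (nonempty_compl.2 hne)]
        simpa using hxΩ
      obtain ⟨n, hn⟩ := exists_nat_gt (4 / infDist x Ωᶜ)
      have h1 : infDist x Ωᶜ ≤ 4 / ((n : ℝ) + 1) := (hx n).2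
      rw [div_lt_iff₀ hpos] at hn
      rw [le_div_iff₀ (by positivity)] at h1
      nlinarith
    rwa [hempty, setIntegral_empty] at this
  have hfin := ge_of_tendsto' ((hlim.const_mul (1 + c)).const_add
    (G * (∫ x in Ω, |ρ x|) + C₀ * κ * G * volume.real Ω)) hstep
  simpa using hfin

/-- Linear growth of the mass of the tilt function on small balls: for every admissible
solution with `∫_Ω |ρ| ≤ I₁`, every `x ∈ Ω`, and every `r ∈ (0, r_x)` where
`r_x = dist(x, ∂Ω)/2`, one has `∫_{B_r(x)} w_u ≤ (C/r_x) r`. -/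
theorem tilt_linear_growth (m : ℕ) (hm : 2 ≤ m)
    (Ω : Set (EuclideanSpace ℝ (Fin m))) (hΩo : IsOpen Ω) (hΩb : Bornology.IsBounded Ω)
    (θ : ℝ) (hθ : θ ∈ Set.Ioo (0 : ℝ) (1/4))
    (φ : EuclideanSpace ℝ (Fin m) → ℝ) (hφ : ContDiff ℝ (⊤ : ℕ∞) φ)
    (hφg : ∀ x ∈ closure Ω, ‖gradient φ x‖ ≤ 1 - 4 * θ)
    (Λ : ℝ) (hΛ : 0 ≤ Λ) (I₁ : ℝ) (hI₁ : 0 ≤ I₁) :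
    ∃ C : ℝ, 0 < C ∧
      ∀ u ρ : EuclideanSpace ℝ (Fin m) → ℝ, IsAdmissible Ω φ Λ u ρ →
        (∫⁻ x in Ω, ENNReal.ofReal |ρ x|) ≤ ENNReal.ofReal I₁ →
        ∀ x ∈ Ω, ∀ r : ℝ, 0 < r → r < Metric.infDist x (frontier Ω) / 2 →
          ∫⁻ y in Metric.ball x r, ENNReal.ofReal (tilt u y)
            ≤ ENNReal.ofReal (C / (Metric.infDist x (frontier Ω) / 2) * r) := by
  have : Nonempty (Fin m) := ⟨⟨0, by omega⟩⟩
  have hne : Ω ≠ univ := by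
    rintro rfl
    exact NormedSpace.unbounded_univ ℝ (EuclideanSpace ℝ (Fin m)) hΩb
  have hθ0 := hθ.1
  set D := diam Ω with hD
  have hD0 : 0 ≤ D := diam_nonneg
  set C₁ := Real.cosh ((Λ + 1) / θ * (2 * D)) * I₁ +
      2 * (√(1 - (1 - 2 * θ) ^ 2))⁻¹ * ((Λ + 1) / θ) *
        Real.cosh ((Λ + 1) / θ * (2 * D)) * volume.real Ω with hC₁
  have hC₁0 : 0 ≤ C₁ := by
    have := Real.cosh_pos ((Λ + 1) / θ * (2 * D))
    positivity
  set b := volume.real (ball (0 : EuclideanSpace ℝ (Fin m)) 1) with hb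
  have hb0 : 0 ≤ b := measureReal_nonneg
  refine ⟨Real.pi * (D * (I₁ + Λ * C₁) + 4 * C₁) + D ^ m * b + 1, by positivity, ?_⟩
  rintro u ρ ⟨⟨V, hV, hΩV, huV⟩, hu1, huφ, hρ, hH⟩ hρI x hx r hr hrR
  set R := infDist x (frontier Ω) / 2 with hR
  have hR0 : 0 < R := hr.trans hrR
  -- an open neighbourhood of the closure on which the graph is spacelike
  have huV2 : ContDiffOn ℝ 2 u V :=
    huV.of_le (WithTop.coe_le_coe.2 (le_top : (2 : ℕ∞) ≤ ⊤))
  set U := V ∩ {y | ‖gradient u y‖ < 1} with hUdef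
  have hU : IsOpen U := by
    have hc := (ContDiffOn.gradient_of_isOpen hV huV2).continuousOn.norm
    exact hc.isOpen_inter_preimage hV (isOpen_Iio (a := (1 : ℝ)))
  have hΩU : closure Ω ⊆ U := fun y hy => ⟨hΩV hy, hu1 y hy⟩
  have hu : ContDiffOn ℝ 2 u U := huV2.mono inter_subset_left
  have hu1U : ∀ y ∈ U, ‖gradient u y‖ < 1 := fun y hy => hy.2
  have huΩ : ContDiffOn ℝ 2 u Ω := hu.mono (subset_closure.trans hΩU)
  have hu1Ω : ∀ y ∈ Ω, ‖gradient u y‖ < 1 := fun y hy => hu1 y (subset_closure hy)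
  have hwi := integrableOn_tilt hΩb hU hΩU hu hu1U
  have hρi : IntegrableOn (fun y => |ρ y|) Ω := by
    refine ⟨(hρ.abs).aestronglyMeasurable hΩo.measurableSet, ?_⟩
    rw [hasFiniteIntegral_iff_ofReal (Filter.Eventually.of_forall fun y => abs_nonneg _)]
    exact hρI.trans_lt ENNReal.ofReal_lt_top
  have hρI' : ∫ y in Ω, |ρ y| ≤ I₁ := by
    rw [integral_eq_lintegral_of_nonneg_ae (Filter.Eventually.of_forall fun y => abs_nonneg _)
      hρi.aestronglyMeasurable]
    exact ENNReal.toReal_le_of_le_ofReal hI₁ hρI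
  have hmass : ∫ y in Ω, tilt u y ≤ C₁ := by
    refine (integral_tilt_le hΩo hΩb hne hU hΩU hu hu1U hθ (hφ.of_le (by exact_mod_cast le_top))
      hφg huφ hΛ hρ hρi hH).trans ?_
    have := Real.cosh_pos ((Λ + 1) / θ * (2 * D))
    rw [hC₁]
    gcongr
  -- geometry of the balls around `x`
  obtain ⟨z, hz, hxz⟩ := exists_mem_frontier_infDist_compl_eq_dist hx hne
  have hRd : 2 * R ≤ infDist x Ωᶜ := by
    rw [hxz, hR]
    have := infDist_le_dist_of_mem (x := x) hz
    linarith
  have hRD : R ≤ D := by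
    have : dist x z ≤ D := by
      rw [hD, ← diam_closure]
      exact dist_le_diam_of_mem hΩb.closure (subset_closure hx) hz.1
    linarith
  have hball : ball x r ⊆ Ω :=
    (ball_subset_ball (by linarith)).trans (ball_infDist_compl_subset (x := x))
  have hfar : ∀ y ∈ ball x r, 4 / (4 / R) < infDist y Ωᶜ := by
    intro y hy
    have h1 := infDist_le_infDist_add_dist (s := Ωᶜ) (x := x) (y := y)
    rw [mem_ball, dist_comm] at hy
    have : 4 / (4 / R) = R := by field_simp
    linarith
  have hlip : ∀ y ∈ ball x r, |u y - u x| ≤ r := by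
    intro y hy
    have := (convex_ball x r).norm_image_sub_le_of_norm_fderiv_le (f := u) (C := 1)
      (fun y hy => (huΩ.differentiableOn two_ne_zero).differentiableAt
        (hΩo.mem_nhds (hball hy)))
      (fun y hy => by rw [← norm_gradient_eq]; exact (hu1Ω y (hball hy)).le)
      (mem_ball_self hr) hy
    rw [one_mul, Real.norm_eq_abs, ← dist_eq_norm] at this
    exact this.trans (mem_ball.1 hy).le
  -- energy inequality with test function `χ arctan ((u - u(x)) / r)`
  obtain ⟨χ, hχ, hc, hs, hχ0, hχ1, hχL, hχe, -⟩ :=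
    exists_contDiff_cutoff hΩb (show 0 < 4 / R by positivity)
  have hKm : MeasurableSet (tsupport χ) := (isClosed_tsupport χ).measurableSet
  have hg : ∀ s, HasDerivAt (fun s => Real.arctan (r⁻¹ * s))
      (1 / (1 + (r⁻¹ * s) ^ 2) * r⁻¹) s := fun s => by
    simpa using ((hasDerivAt_id s).const_mul r⁻¹).arctan
  have hg'c : Continuous fun s : ℝ => 1 / (1 + (r⁻¹ * s) ^ 2) * r⁻¹ := by
    refine (continuous_const.div (by fun_prop) fun s => ?_).mul continuous_const
    positivity
  have hvc : ContDiffOn ℝ 1 (fun y => u y - u x) Ω :=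
    (huΩ.of_le (by norm_num)).sub contDiffOn_const
  obtain ⟨hBi, hB⟩ := energy_inequality hΩo huΩ hu1Ω hvc hg hg'c hχ hc hs hχ0 hρ hH
  have hDv : ∀ y, fderiv ℝ (fun y => u y - u x) y (gradient u y) = ‖gradient u y‖ ^ 2 := by
    intro y
    rw [fderiv_sub_const, ← inner_gradient_left, real_inner_self_eq_norm_sq]
  simp only [hDv] at hBi hB
  set F : EuclideanSpace ℝ (Fin m) → ℝ := fun y =>
    χ y * (1 / (1 + (r⁻¹ * (u y - u x)) ^ 2) * r⁻¹ * (tilt u y * ‖gradient u y‖ ^ 2)) with hF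
  have hF0 : ∀ y, 0 ≤ F y := fun y => by
    have := hχ0 y
    have := tilt_nonneg u y
    simp only [hF]
    positivity
  have hFi : IntegrableOn F (tsupport χ) := by
    refine ContinuousOn.integrableOn_compact hc ?_
    exact hχ.continuous.continuousOn.mul
      ((hg'c.comp_continuousOn (hvc.continuousOn.mono hs)).mul
        (((contDiffOn_tilt hΩo huΩ hu1Ω).continuousOn.mono hs).mul
        (((ContDiffOn.gradient_of_isOpen hΩo huΩ).continuousOn.mono hs).norm.pow 2)))
  have hRi : IntegrableOn (fun y => Real.pi / 2 * ((4 / R + Λ) * tilt u y + |ρ y|)) Ω :=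
    ((hwi.const_mul _).add hρi).const_mul _
  have hFK : ∫ y in tsupport χ, F y ≤ Real.pi / 2 * ((4 / R + Λ) * C₁ + I₁) := by
    have hpt : ∀ y ∈ tsupport χ, F y ≤ (F y -
        (|Real.arctan (r⁻¹ * (u y - u x))| * (tilt u y * ‖fderiv ℝ χ y‖) +
        χ y * (|Real.arctan (r⁻¹ * (u y - u x))| * (|ρ y| + Λ * tilt u y)))) +
        Real.pi / 2 * ((4 / R + Λ) * tilt u y + |ρ y|) := by
      intro y _
      have hw := tilt_nonneg u y
      have ha : |Real.arctan (r⁻¹ * (u y - u x))| ≤ Real.pi / 2 :=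
        abs_le.2 ⟨(Real.neg_pi_div_two_lt_arctan _).le, (Real.arctan_lt_pi_div_two _).le⟩
      have hL := hχL y
      have h1 : |Real.arctan (r⁻¹ * (u y - u x))| * (tilt u y * ‖fderiv ℝ χ y‖) ≤
          Real.pi / 2 * (tilt u y * (4 / R)) := by gcongr
      have h2 : χ y * (|Real.arctan (r⁻¹ * (u y - u x))| * (|ρ y| + Λ * tilt u y)) ≤
          1 * (Real.pi / 2 * (|ρ y| + Λ * tilt u y)) := by
        gcongr
        exact hχ1 y
      linarith
    have h1 := setIntegral_mono_on hFi (hBi.add (hRi.mono_set hs)) hKm hpt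
    simp only [Pi.add_apply] at h1
    rw [integral_add hBi (hRi.mono_set hs)] at h1
    have h2 := setIntegral_mono_set hRi (Filter.Eventually.of_forall fun y => by
      have := tilt_nonneg u y
      change 0 ≤ Real.pi / 2 * ((4 / R + Λ) * tilt u y + |ρ y|)
      positivity) (LE.le.eventuallyLE hs)
    have h3 : ∫ y in Ω, Real.pi / 2 * ((4 / R + Λ) * tilt u y + |ρ y|) ≤
        Real.pi / 2 * ((4 / R + Λ) * C₁ + I₁) := by
      rw [integral_const_mul, integral_add (hwi.const_mul _) hρi, integral_const_mul]
      gcongr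
    linarith
  have hwB : IntegrableOn (tilt u) (ball x r) := hwi.mono_set hball
  have hone : IntegrableOn (fun _ : EuclideanSpace ℝ (Fin m) => (1 : ℝ)) (ball x r) :=
    integrableOn_const measure_ball_lt_top.ne
  have hBK : ∫ y in ball x r, (tilt u y - 1) ≤ 2 * r * ∫ y in tsupport χ, F y := by
    have hsub : ball x r ⊆ tsupport χ := fun y hy =>
      subset_tsupport χ (by simp [hχe y (hfar y hy)])
    have h1 := setIntegral_mono_set hFi (Filter.Eventually.of_forall hF0)
      (LE.le.eventuallyLE hsub)
    have h2 : ∫ y in ball x r, (tilt u y - 1) ≤ ∫ y in ball x r, 2 * r * F y := by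
      refine setIntegral_mono_on (hwB.sub hone) ((hFi.mono_set hsub).const_mul _)
        measurableSet_ball fun y hy => ?_
      have hw := tilt_nonneg u y
      have ha1 := hu1Ω y (hball hy)
      have ha0 := norm_nonneg (gradient u y)
      have hpos : 0 < 1 - ‖gradient u y‖ ^ 2 := by nlinarith
      have h3 : tilt u y - 1 ≤ tilt u y * ‖gradient u y‖ ^ 2 := by
        have hs0 := Real.sqrt_pos.2 hpos
        have hs1 : √(1 - ‖gradient u y‖ ^ 2) ≤ 1 := Real.sqrt_le_one.2 (by nlinarith)
        have hsq := Real.sq_sqrt hpos.le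
        have hws : tilt u y * √(1 - ‖gradient u y‖ ^ 2) = 1 := inv_mul_cancel₀ hs0.ne'
        have : tilt u y * (1 - ‖gradient u y‖ ^ 2) = √(1 - ‖gradient u y‖ ^ 2) := by
          rw [← hsq, sq, ← mul_assoc, hws, one_mul, ← sq, hsq]
        linarith
      have h4 : 1 ≤ 2 * r * (1 / (1 + (r⁻¹ * (u y - u x)) ^ 2) * r⁻¹) := by
        have h5 : (r⁻¹ * (u y - u x)) ^ 2 ≤ 1 := by
          rw [sq_le_one_iff_abs_le_one, abs_mul, abs_of_pos (inv_pos.2 hr),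
            inv_mul_le_iff₀ hr, mul_one]
          exact hlip y hy
        have : 2 * r * (1 / (1 + (r⁻¹ * (u y - u x)) ^ 2) * r⁻¹) =
            2 / (1 + (r⁻¹ * (u y - u x)) ^ 2) := by field_simp
        rw [this, le_div_iff₀ (by positivity)]
        linarith
      calc tilt u y - 1 ≤ 1 * (tilt u y * ‖gradient u y‖ ^ 2) := by linarith
        _ ≤ 2 * r * (1 / (1 + (r⁻¹ * (u y - u x)) ^ 2) * r⁻¹) *
            (tilt u y * ‖gradient u y‖ ^ 2) := by gcongr
        _ = 2 * r * F y := by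
            simp only [hF, hχe y (hfar y hy)]
            ring
    rw [integral_const_mul] at h2
    exact h2.trans (mul_le_mul_of_nonneg_left h1 (by positivity))
  have hvol : ∫ _ in ball x r, (1 : ℝ) = r ^ m * b := by
    rw [setIntegral_const, smul_eq_mul, mul_one, hb, measureReal_def, measureReal_def,
      Measure.addHaar_ball _ _ hr.le, ENNReal.toReal_mul,
      ENNReal.toReal_ofReal (by positivity)]
    simp
  rw [integral_sub hwB hone, hvol] at hBK
  have hfinal : ∫ y in ball x r, tilt u y ≤
      (Real.pi * (D * (I₁ + Λ * C₁) + 4 * C₁) + D ^ m * b + 1) / R * r := by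
    have h1 : 2 * r * ∫ y in tsupport χ, F y ≤
        Real.pi * (D * (I₁ + Λ * C₁) + 4 * C₁) / R * r := by
      calc 2 * r * ∫ y in tsupport χ, F y
          ≤ 2 * r * (Real.pi / 2 * ((4 / R + Λ) * C₁ + I₁)) := by gcongr
        _ = Real.pi * (R * (I₁ + Λ * C₁) + 4 * C₁) / R * r := by field_simp; ring
        _ ≤ _ := by gcongr
    have h2 : r ^ m * b ≤ D ^ m * b / R * r := by
      obtain ⟨n, rfl⟩ : ∃ n, m = n + 1 := ⟨m - 1, by omega⟩
      calc r ^ (n + 1) * b = r ^ n * R * b / R * r := by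
            field_simp
            ring
        _ ≤ D ^ n * D * b / R * r := by
            gcongr
            exact hrR.le.trans hRD
        _ = _ := by rw [pow_succ]
    have h3 : 0 ≤ 1 / R * r := by positivity
    rw [add_div, add_div, add_mul, add_mul]
    linarith
  rw [← ofReal_integral_eq_lintegral_ofReal hwB
    (Filter.Eventually.of_forall fun y => tilt_nonneg u y)]
  exact ENNReal.ofReal_le_ofReal hfinal
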